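/- Let p ≥ 0 be an integer and let κ* > 0 satisfy J_p(κ*) = 0. Let y₋ < κ* < y₊ be real numbers such that κ* is the only zero of J_p in the interval [y₋, y₊], and let C > 0. Let κ : (1, ∞) → ℂ be a continuous ITE trajectory, i.e. F_p(κ(n), n) = 0 for all n > 1, satisfying y₋ ≤ Re κ(n) ≤ y₊ and −C ≤ Im κ(n) ≤ C for all n > 1, and assume the set { n > 1 : κ(n) = κ* } is unbounded. Then lim_{n→∞} κ(n) = κ*. -/

import Mathlib

open Complex Real Filter Set

/-- Bessel function of the first kind of integer order `p`. -/
noncomputable def besselJ (p : ℕ) (z : ℂ) : ℂ :=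
  ∑' m : ℕ, ((-1 : ℂ) ^ m / ((Nat.factorial m : ℂ) * (Nat.factorial (m + p) : ℂ)))
    * (z / 2) ^ (2 * m + p)

/-- Derivative of the Bessel function. -/
noncomputable def besselJ' (p : ℕ) (z : ℂ) : ℂ := deriv (besselJ p) z

/-- The ITE determinant function `F_p(κ, n)`. -/
noncomputable def Fp (p : ℕ) (κ : ℂ) (n : ℝ) : ℂ :=
  κ * (besselJ' p κ * besselJ p ((Real.sqrt n : ℂ) * κ)
    - (Real.sqrt n : ℂ) * besselJ p κ * besselJ' p ((Real.sqrt n : ℂ) * κ))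

/-- Coefficient of `z ^ (2 * m + p)` in the power series of `besselJ p`. -/
noncomputable def besselCoeff (p m : ℕ) : ℂ :=
  (-1 : ℂ) ^ m / ((Nat.factorial m : ℂ) * (Nat.factorial (m + p) : ℂ)) / 2 ^ (2 * m + p)

theorem besselJ_eq_tsum (p : ℕ) (z : ℂ) :
    besselJ p z = ∑' m, besselCoeff p m * z ^ (2 * m + p) := by
  unfold besselJ besselCoeff
  refine tsum_congr fun m => ?_
  rw [div_pow]
  ring

section EntireSeries

variable {a : ℕ → ℂ} {e : ℕ → ℕ}

theorem summable_exponent_mul (h : ∀ R : ℝ, 0 ≤ R → Summable fun m => ‖a m‖ * R ^ e m)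
    (R : ℝ) (hR : 0 ≤ R) : Summable fun m => ‖(e m : ℂ) * a m‖ * R ^ e m := by
  refine (h (2 * R) (by positivity)).of_nonneg_of_le (fun m => by positivity) fun m => ?_
  have : (e m : ℝ) ≤ 2 ^ e m := by exact_mod_cast (Nat.lt_two_pow_self).le
  rw [norm_mul, Complex.norm_natCast, mul_pow]
  calc (e m : ℝ) * ‖a m‖ * R ^ e m ≤ 2 ^ e m * ‖a m‖ * R ^ e m := by gcongr
    _ = _ := by ring

theorem summable_term (h : ∀ R : ℝ, 0 ≤ R → Summable fun m => ‖a m‖ * R ^ e m) (z : ℂ) :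
    Summable fun m => a m * z ^ e m :=
  Summable.of_norm (by simpa using h ‖z‖ (norm_nonneg z))

theorem differentiable_tsum_pow (h : ∀ R : ℝ, 0 ≤ R → Summable fun m => ‖a m‖ * R ^ e m) :
    Differentiable ℂ fun z => ∑' m, a m * z ^ e m := by
  intro z
  have hz : z ∈ Metric.ball (0 : ℂ) (‖z‖ + 1) := by simp
  refine (Complex.differentiableOn_tsum_of_summable_norm (h (‖z‖ + 1) (by positivity))
    (fun m => by fun_prop) Metric.isOpen_ball fun m w hw => ?_).differentiableAt
    (Metric.isOpen_ball.mem_nhds hz)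
  rw [norm_mul, norm_pow]
  gcongr
  simpa using (mem_ball_zero_iff.1 hw).le

theorem mul_deriv_tsum_pow (h : ∀ R : ℝ, 0 ≤ R → Summable fun m => ‖a m‖ * R ^ e m) (z : ℂ) :
    z * deriv (fun z => ∑' m, a m * z ^ e m) z = ∑' m, ((e m : ℂ) * a m) * z ^ e m := by
  have hz : z ∈ Metric.ball (0 : ℂ) (‖z‖ + 1) := by simp
  have := Complex.hasSum_deriv_of_summable_norm (F := fun m z => a m * z ^ e m)
    (h (‖z‖ + 1) (by positivity))
    (fun m => by fun_prop) Metric.isOpen_ball (fun m w hw => by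
      rw [norm_mul, norm_pow]
      gcongr
      simpa using (mem_ball_zero_iff.1 hw).le) hz
  rw [← (this.mul_left z).tsum_eq]
  refine tsum_congr fun m => ?_
  rw [deriv_const_mul _ (by fun_prop), deriv_pow_field]
  rcases Nat.eq_zero_or_pos (e m) with h0 | h0
  · simp [h0]
  · obtain ⟨k, hk⟩ := Nat.exists_eq_succ_of_ne_zero h0.ne'
    rw [hk]
    simp only [Nat.succ_eq_add_one, Nat.add_sub_cancel]
    ring

end EntireSeries

theorem norm_besselCoeff_le (p m : ℕ) : ‖besselCoeff p m‖ ≤ 1 / (Nat.factorial m : ℝ) := by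
  unfold besselCoeff
  simp only [norm_div, norm_pow, norm_neg, norm_one, one_pow, norm_mul, Complex.norm_natCast,
    Complex.norm_ofNat, div_div]
  have h1 : (1 : ℝ) ≤ Nat.factorial (m + p) := by exact_mod_cast Nat.factorial_pos _
  have h2 : (1 : ℝ) ≤ 2 ^ (2 * m + p) := one_le_pow₀ (by norm_num)
  gcongr
  rw [mul_assoc]
  exact le_mul_of_one_le_right (by positivity) (one_le_mul_of_one_le_of_one_le h1 h2)

theorem summable_besselCoeff (p q : ℕ) (R : ℝ) (hR : 0 ≤ R) :
    Summable fun m => ‖besselCoeff p m‖ * R ^ (2 * m + q) := by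
  refine ((Real.summable_pow_div_factorial (R ^ 2)).mul_right (R ^ q)).of_nonneg_of_le
    (fun m => by positivity) fun m => ?_
  calc ‖besselCoeff p m‖ * R ^ (2 * m + q) ≤ 1 / (Nat.factorial m : ℝ) * R ^ (2 * m + q) := by
        gcongr
        exact norm_besselCoeff_le p m
    _ = _ := by ring

theorem differentiable_besselJ (p : ℕ) : Differentiable ℂ (besselJ p) := by
  rw [funext (besselJ_eq_tsum p)]
  exact differentiable_tsum_pow (summable_besselCoeff p p)

/-- The Euler derivative `z * J_p'(z)` of the Bessel function. -/
noncomputable def besselT (p : ℕ) (z : ℂ) : ℂ := z * besselJ' p z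

theorem besselT_eq_tsum (p : ℕ) (z : ℂ) :
    besselT p z = ∑' m, (((2 * m + p : ℕ) : ℂ) * besselCoeff p m) * z ^ (2 * m + p) := by
  rw [besselT, besselJ', funext (besselJ_eq_tsum p)]
  exact mul_deriv_tsum_pow (summable_besselCoeff p p) z

theorem differentiable_besselT (p : ℕ) : Differentiable ℂ (besselT p) := by
  rw [funext (besselT_eq_tsum p)]
  exact differentiable_tsum_pow (summable_exponent_mul (summable_besselCoeff p p))

theorem besselCoeff_succ (p m : ℕ) :
    4 * ((m : ℂ) + 1) * (m + 1 + p) * besselCoeff p (m + 1) = -besselCoeff p m := by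
  unfold besselCoeff
  have h1 : (Nat.factorial (m + 1) : ℂ) = (m + 1) * Nat.factorial m := by
    rw [Nat.factorial_succ]; push_cast; ring
  have h2 : (Nat.factorial (m + 1 + p) : ℂ) = (m + 1 + p) * Nat.factorial (m + p) := by
    rw [show m + 1 + p = (m + p) + 1 by ring, Nat.factorial_succ]; push_cast; ring
  have h3 : ((m : ℂ) + 1) ≠ 0 := by exact_mod_cast Nat.succ_ne_zero m
  have h4 : ((m : ℂ) + 1 + p) ≠ 0 := by
    exact_mod_cast (by omega : m + 1 + p ≠ 0)
  have h5 : (Nat.factorial m : ℂ) ≠ 0 := by exact_mod_cast Nat.factorial_ne_zero m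
  have h6 : (Nat.factorial (m + p) : ℂ) ≠ 0 := by exact_mod_cast Nat.factorial_ne_zero _
  rw [h1, h2, show 2 * (m + 1) + p = 2 * m + p + 2 by ring, pow_add, pow_succ]
  field_simp
  ring

/-- Bessel's differential equation. -/
theorem mul_deriv_besselT (p : ℕ) (z : ℂ) :
    z * deriv (besselT p) z = ((p : ℂ) ^ 2 - z ^ 2) * besselJ p z := by
  have hs := summable_besselCoeff p p
  have hs2 := summable_exponent_mul (summable_exponent_mul hs)
  have h1 : z * deriv (besselT p) z = ∑' m, (((2 * m + p : ℕ) : ℂ) *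
      (((2 * m + p : ℕ) : ℂ) * besselCoeff p m)) * z ^ (2 * m + p) := by
    rw [funext (besselT_eq_tsum p)]
    exact mul_deriv_tsum_pow (summable_exponent_mul hs) z
  have hJ := summable_term hs z
  rw [h1, sub_mul, eq_sub_iff_add_eq, ← eq_sub_iff_add_eq', besselJ_eq_tsum, ← tsum_mul_left,
    ← tsum_mul_left, ← (hJ.mul_left _).tsum_sub (summable_term hs2 z),
    ((hJ.mul_left _).sub (summable_term hs2 z)).tsum_eq_zero_add]
  simp only [mul_zero, zero_add]
  rw [show (p : ℂ) ^ 2 * (besselCoeff p 0 * z ^ p) - (p : ℂ) * (p * besselCoeff p 0) * z ^ p = 0 by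
    ring, zero_add]
  refine tsum_congr fun m => ?_
  have := besselCoeff_succ p m
  rw [show 2 * (m + 1) + p = 2 * m + p + 2 by ring, pow_add _ _ 2]
  push_cast
  linear_combination (z ^ (2 * m + p) * z ^ 2) * this

theorem conj_besselJ (p : ℕ) (z : ℂ) :
    (starRingEnd ℂ) (besselJ p z) = besselJ p ((starRingEnd ℂ) z) := by
  simp [besselJ, Complex.conj_tsum, Complex.conj_ofNat]

theorem besselJ_zero_neg (z : ℂ) : besselJ 0 (-z) = besselJ 0 z := by
  unfold besselJ
  refine tsum_congr fun m => ?_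
  rw [neg_div, add_zero (2 * m), (even_two_mul m).neg_pow]

theorem besselJ_apply_zero_of_pos {p : ℕ} (hp : 0 < p) : besselJ p 0 = 0 := by
  simp [besselJ, hp.ne']

theorem eventually_besselJ_ne_zero (p : ℕ) :
    ∀ᶠ z in nhds (0 : ℂ), z ≠ 0 → besselJ p z ≠ 0 := by
  have hE : Continuous fun z : ℂ => ∑' m, besselCoeff p m * z ^ (2 * m) :=
    (differentiable_tsum_pow (summable_besselCoeff p 0)).continuous
  have h0 : (∑' m, besselCoeff p m * (0 : ℂ) ^ (2 * m)) ≠ 0 := by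
    rw [tsum_eq_single 0 (fun m hm => by simp [hm])]
    simp [besselCoeff, Nat.factorial_ne_zero]
  filter_upwards [hE.continuousAt.eventually_ne h0] with z hz hz0
  have : besselJ p z = z ^ p * ∑' m, besselCoeff p m * z ^ (2 * m) := by
    rw [besselJ_eq_tsum, ← tsum_mul_left]
    exact tsum_congr fun m => by ring
  rw [this]
  exact mul_ne_zero (pow_ne_zero _ hz0) hz

theorem besselJ_zero_apply_zero_ne : besselJ 0 0 ≠ 0 := by
  rw [besselJ, tsum_eq_single 0 (fun m hm => by simp [hm])]
  simp

theorem conj_besselT (p : ℕ) (z : ℂ) :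
    (starRingEnd ℂ) (besselT p z) = besselT p ((starRingEnd ℂ) z) := by
  simp [besselT_eq_tsum, besselCoeff, Complex.conj_tsum, Complex.conj_ofNat]

section Ray

theorem hasDerivAt_besselJ_ray (p : ℕ) (z : ℂ) {s : ℝ} (hs : s ≠ 0) :
    HasDerivAt (fun s : ℝ => besselJ p (z * s)) (besselT p (z * s) / s) s := by
  have h1 : HasDerivAt (fun s : ℝ => z * (s : ℂ)) (z * 1) s :=
    (Complex.ofRealCLM.hasDerivAt (x := s)).const_mul z
  refine ((differentiable_besselJ p (z * s)).hasDerivAt.comp s h1).congr_deriv ?_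
  have : (s : ℂ) ≠ 0 := by exact_mod_cast hs
  rw [besselT, besselJ']
  field_simp

theorem hasDerivAt_besselT_ray (p : ℕ) (z : ℂ) {s : ℝ} (hs : s ≠ 0) :
    HasDerivAt (fun s : ℝ => besselT p (z * s))
      (((p : ℂ) ^ 2 - (z * s) ^ 2) * besselJ p (z * s) / s) s := by
  have h1 : HasDerivAt (fun s : ℝ => z * (s : ℂ)) (z * 1) s :=
    (Complex.ofRealCLM.hasDerivAt (x := s)).const_mul z
  refine ((differentiable_besselT p (z * s)).hasDerivAt.comp s h1).congr_deriv ?_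
  have : (s : ℂ) ≠ 0 := by exact_mod_cast hs
  rw [← mul_deriv_besselT]
  field_simp

@[fun_prop]
theorem continuous_besselJ (p : ℕ) : Continuous (besselJ p) := (differentiable_besselJ p).continuous

@[fun_prop]
theorem continuous_besselT (p : ℕ) : Continuous (besselT p) := (differentiable_besselT p).continuous

theorem besselT_apply_zero (p : ℕ) : besselT p 0 = 0 := by simp [besselT]

/-- Lommel's integral for the product of two Bessel functions. -/
theorem integral_besselJ_mul_besselJ (p : ℕ) (z w : ℂ) :
    (w ^ 2 - z ^ 2) * ∫ s in (0 : ℝ)..1, (s : ℂ) * (besselJ p (z * s) * besselJ p (w * s)) =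
      besselT p z * besselJ p w - besselJ p z * besselT p w := by
  rw [← intervalIntegral.integral_const_mul,
    intervalIntegral.integral_eq_sub_of_hasDerivAt_of_le
      (f := fun s : ℝ => besselT p (z * s) * besselJ p (w * s)
        - besselJ p (z * s) * besselT p (w * s)) zero_le_one (by fun_prop) ?_
      (Continuous.intervalIntegrable (by fun_prop) _ _)]
  · simp [besselT_apply_zero]
  · intro s hs
    have hs0 := hs.1.ne'
    have : (s : ℂ) ≠ 0 := by exact_mod_cast hs0
    refine (((hasDerivAt_besselT_ray p z hs0).fun_mul (hasDerivAt_besselJ_ray p w hs0)).fun_sub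
      ((hasDerivAt_besselJ_ray p z hs0).fun_mul (hasDerivAt_besselT_ray p w hs0))).congr_deriv ?_
    field_simp
    ring

/-- Lommel's integral for the square of a Bessel function. -/
theorem integral_besselJ_sq (p : ℕ) (z : ℂ) :
    2 * z ^ 2 * ∫ s in (0 : ℝ)..1, (s : ℂ) * besselJ p (z * s) ^ 2 =
      (z ^ 2 - (p : ℂ) ^ 2) * besselJ p z ^ 2 + besselT p z ^ 2 := by
  rw [← intervalIntegral.integral_const_mul,
    intervalIntegral.integral_eq_sub_of_hasDerivAt_of_le
      (f := fun s : ℝ => ((z * s) ^ 2 - (p : ℂ) ^ 2) * besselJ p (z * s) ^ 2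
        + besselT p (z * s) ^ 2) zero_le_one (by fun_prop) ?_
      (Continuous.intervalIntegrable (by fun_prop) _ _)]
  · rcases Nat.eq_zero_or_pos p with rfl | hp
    · simp [besselT_apply_zero]
    · simp [besselT_apply_zero, besselJ_apply_zero_of_pos hp]
  · intro s hs
    have hs0 := hs.1.ne'
    have : (s : ℂ) ≠ 0 := by exact_mod_cast hs0
    have h1 : HasDerivAt (fun s : ℝ => (z * (s : ℂ)) ^ 2 - (p : ℂ) ^ 2)
        (2 * (z * s) * (z * 1)) s := by
      simpa using (((Complex.ofRealCLM.hasDerivAt (x := s)).const_mul z).pow 2).sub_const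
        ((p : ℂ) ^ 2)
    refine ((h1.fun_mul ((hasDerivAt_besselJ_ray p z hs0).fun_pow 2)).fun_add
      ((hasDerivAt_besselT_ray p z hs0).fun_pow 2)).congr_deriv ?_
    push_cast
    field_simp
    ring

/-- The mean of `J_0` over a ray determines `z * J_0'(z)`. -/
theorem besselT_zero_eq_integral (z : ℂ) :
    besselT 0 z = -z ^ 2 * ∫ s in (0 : ℝ)..1, (s : ℂ) * besselJ 0 (z * s) := by
  rw [← intervalIntegral.integral_const_mul,
    intervalIntegral.integral_eq_sub_of_hasDerivAt_of_le
      (f := fun s : ℝ => besselT 0 (z * s)) zero_le_one (by fun_prop) ?_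
      (Continuous.intervalIntegrable (by fun_prop) _ _)]
  · simp [besselT_apply_zero]
  · intro s hs
    have hs0 := hs.1.ne'
    have : (s : ℂ) ≠ 0 := by exact_mod_cast hs0
    refine (hasDerivAt_besselT_ray 0 z hs0).congr_deriv ?_
    push_cast
    field_simp
    ring

/-- The weighted `L²` mass of `J_p` on the segment from `0` to `z`. -/
noncomputable def besselMass (p : ℕ) (z : ℂ) : ℝ :=
  ∫ s in (0 : ℝ)..1, s * ‖besselJ p (z * s)‖ ^ 2

theorem continuous_besselMass (p : ℕ) : Continuous (besselMass p) :=
  intervalIntegral.continuous_parametric_intervalIntegral_of_continuous'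
    (f := fun (z : ℂ) (s : ℝ) => s * ‖besselJ p (z * s)‖ ^ 2)
    (by unfold Function.uncurry; fun_prop) 0 1

theorem besselMass_pos (p : ℕ) {z : ℂ} (hz : z ≠ 0) : 0 < besselMass p z := by
  have ht : Tendsto (fun s : ℝ => z * (s : ℂ)) (nhds 0) (nhds 0) := by
    have : Continuous fun s : ℝ => z * (s : ℂ) := by fun_prop
    simpa using this.tendsto 0
  obtain ⟨ε, hε, h⟩ := Metric.eventually_nhds_iff.1 (ht.eventually (eventually_besselJ_ne_zero p))
  set c := min (ε / 2) 1
  have hc : 0 < c := by positivity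
  refine intervalIntegral.integral_pos zero_lt_one (by fun_prop)
    (fun s hs => mul_nonneg hs.1.le (by positivity)) ⟨c, ⟨hc.le, min_le_right _ _⟩, ?_⟩
  have hc0 : (c : ℂ) ≠ 0 := by exact_mod_cast hc.ne'
  have := h (y := c) (by
    rw [dist_zero_right, Real.norm_of_nonneg hc.le]
    exact (min_le_left _ _).trans_lt (by linarith)) (mul_ne_zero hz hc0)
  positivity

theorem im_besselT_mul_conj (p : ℕ) (z : ℂ) :
    (besselT p z * (starRingEnd ℂ) (besselJ p z)).im = -(z ^ 2).im * besselMass p z := by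
  have h := integral_besselJ_mul_besselJ p z ((starRingEnd ℂ) z)
  have hI : (∫ s in (0 : ℝ)..1, (s : ℂ) * (besselJ p (z * s) * besselJ p ((starRingEnd ℂ) z * s))) =
      (besselMass p z : ℂ) := by
    rw [besselMass, ← intervalIntegral.integral_ofReal]
    refine intervalIntegral.integral_congr fun s _ => ?_
    have : (starRingEnd ℂ) z * s = (starRingEnd ℂ) (z * s) := by simp
    simp only [this, ← conj_besselJ, Complex.mul_conj, Complex.normSq_eq_norm_sq]
    push_cast
    rfl
  rw [hI, ← conj_besselJ, ← conj_besselT] at h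
  have h2 := congrArg Complex.im h
  simp [pow_two] at h2 ⊢
  linarith

theorem integral_besselJ_sq_of_real (p : ℕ) {z : ℂ}
    (hr : ∀ s : ℝ, (starRingEnd ℂ) (besselJ p (z * s)) = besselJ p (z * s)) :
    2 * z ^ 2 * besselMass p z =
      (z ^ 2 - (p : ℂ) ^ 2) * besselJ p z ^ 2 + besselT p z ^ 2 := by
  rw [← integral_besselJ_sq, besselMass, ← intervalIntegral.integral_ofReal]
  congr 1
  refine intervalIntegral.integral_congr fun s _ => ?_
  have : (‖besselJ p (z * s)‖ ^ 2 : ℂ) = besselJ p (z * s) ^ 2 := by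
    rw [← Complex.mul_conj', hr, pow_two]
  simp [this]

end Ray

section LowerBound

theorem sq_integral_le_integral_sq {h : ℝ → ℝ} (hh : Continuous h) (a : ℝ) :
    (∫ s in a..a + 1, h s) ^ 2 ≤ ∫ s in a..a + 1, h s ^ 2 := by
  set m := ∫ s in a..a + 1, h s with hm
  have h0 : 0 ≤ ∫ s in a..a + 1, (h s - m) ^ 2 :=
    intervalIntegral.integral_nonneg (by linarith) fun s _ => sq_nonneg _
  have h1 : ∫ s in a..a + 1, (h s - m) ^ 2 = (∫ s in a..a + 1, h s ^ 2) - 2 * m * m + m ^ 2 := by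
    have : ∀ s, (h s - m) ^ 2 = h s ^ 2 - 2 * m * h s + m ^ 2 := fun s => by ring
    simp only [this]
    rw [intervalIntegral.integral_add (Continuous.intervalIntegrable (by fun_prop) _ _)
      (Continuous.intervalIntegrable (by fun_prop) _ _), intervalIntegral.integral_sub
      (Continuous.intervalIntegrable (by fun_prop) _ _)
      (Continuous.intervalIntegrable (by fun_prop) _ _), intervalIntegral.integral_const_mul,
      intervalIntegral.integral_const, ← hm]
    simp
  nlinarith

/-- An endpoint value of a Bessel function along a ray is bounded by its mean over the adjacent
interval of length one. -/
theorem norm_besselJ_le_integral (p : ℕ) {κ : ℂ} {R : ℝ} (hκ : ‖κ‖ ≤ R) {N : ℝ} (hN : 2 ≤ N) :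
    ‖besselJ p (κ * N)‖ ≤ ((p : ℝ) ^ 2 + R ^ 2 + 13) *
      ∫ s in (N - 1)..N, ‖besselJ p (κ * s)‖ := by
  set τ : ℝ → ℝ := fun s => s - (N - 1) with hτ
  set g : ℝ → ℂ := fun s => ((τ s : ℂ) ^ 2 * (1 - τ s) * ((p : ℂ) ^ 2 - (κ * s) ^ 2) / s
    - (2 * τ s - 3 * (τ s : ℂ) ^ 2) - s * (2 - 6 * τ s)) * besselJ p (κ * s) with hg
  have hpos : ∀ s ∈ Icc (N - 1) N, (s : ℂ) ≠ 0 := fun s hs => by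
    exact_mod_cast (show s ≠ 0 by linarith [hs.1])
  have hcont : ContinuousOn g (Icc (N - 1) N) := by
    refine ContinuousOn.mul (ContinuousOn.sub (ContinuousOn.sub (ContinuousOn.div ?_ ?_ hpos)
      ?_) ?_) ?_ <;> fun_prop
  have hint : ∫ s in (N - 1)..N, g s = N * besselJ p (κ * N) := by
    rw [intervalIntegral.integral_eq_sub_of_hasDerivAt_of_le
      (f := fun s : ℝ => (τ s : ℂ) ^ 2 * (1 - τ s) * besselT p (κ * s)
        - s * (2 * τ s - 3 * (τ s : ℂ) ^ 2) * besselJ p (κ * s)) (by linarith) (by fun_prop) ?_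
      (hcont.intervalIntegrable_of_Icc (by linarith))]
    · simp [hτ]
      ring
    · intro s hs
      have hs0 : s ≠ 0 := by linarith [hs.1]
      have hsc : (s : ℂ) ≠ 0 := by exact_mod_cast hs0
      have h1 : HasDerivAt (fun s : ℝ => (τ s : ℂ)) 1 s := by
        exact_mod_cast ((hasDerivAt_id s).sub_const (N - 1)).ofReal_comp
      have h2 : HasDerivAt (fun s : ℝ => (s : ℂ)) 1 s := by
        simpa using (hasDerivAt_id s).ofReal_comp
      refine ((((h1.fun_pow 2).fun_mul (h1.const_sub 1)).fun_mul
        (hasDerivAt_besselT_ray p κ hs0)).fun_sub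
        ((h2.fun_mul ((h1.const_mul 2).fun_sub ((h1.fun_pow 2).const_mul 3))).fun_mul
          (hasDerivAt_besselJ_ray p κ hs0))).congr_deriv ?_
      simp only [hg]
      push_cast
      field_simp
      ring
  have hbound : ∀ s ∈ Ioc (N - 1) N,
      ‖g s‖ ≤ (((p : ℝ) ^ 2 + R ^ 2 + 13) * N) * ‖besselJ p (κ * s)‖ := by
    intro s hs
    have hs1 : 1 ≤ s := by linarith [hs.1]
    have ht0 : 0 ≤ τ s := by simp only [hτ]; linarith [hs.1]
    have ht1 : τ s ≤ 1 := by simp only [hτ]; linarith [hs.2]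
    rw [hg, norm_mul]
    refine mul_le_mul_of_nonneg_right ?_ (norm_nonneg _)
    have e1 : ‖(τ s : ℂ) ^ 2 * (1 - τ s)‖ ≤ 1 := by
      rw [show (τ s : ℂ) ^ 2 * (1 - τ s) = ((τ s ^ 2 * (1 - τ s) : ℝ) : ℂ) by push_cast; rfl,
        Complex.norm_real, Real.norm_eq_abs, abs_le]
      constructor <;> nlinarith [mul_nonneg ht0 ht0, mul_nonneg (mul_nonneg ht0 ht0) ht0]
    have e2 : ‖2 * (τ s : ℂ) - 3 * (τ s : ℂ) ^ 2‖ ≤ 5 := by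
      rw [show 2 * (τ s : ℂ) - 3 * (τ s : ℂ) ^ 2 = ((2 * τ s - 3 * τ s ^ 2 : ℝ) : ℂ) by
        push_cast; rfl, Complex.norm_real, Real.norm_eq_abs, abs_le]
      constructor <;> nlinarith
    have e3 : ‖2 - 6 * (τ s : ℂ)‖ ≤ 8 := by
      rw [show 2 - 6 * (τ s : ℂ) = ((2 - 6 * τ s : ℝ) : ℂ) by push_cast; rfl,
        Complex.norm_real, Real.norm_eq_abs, abs_le]
      constructor <;> nlinarith
    have e4 : ‖((p : ℂ) ^ 2 - (κ * s) ^ 2) / s‖ ≤ (p : ℝ) ^ 2 + R ^ 2 * N := by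
      have hns : ‖(s : ℂ)‖ = s := by rw [Complex.norm_real, Real.norm_of_nonneg (by linarith)]
      rw [norm_div, hns, div_le_iff₀ (by linarith)]
      refine (norm_sub_le _ _).trans ?_
      rw [norm_pow, norm_pow, norm_mul, hns, Complex.norm_natCast, mul_pow]
      have hk : ‖κ‖ ^ 2 ≤ R ^ 2 := pow_le_pow_left₀ (norm_nonneg _) hκ 2
      have a1 : (p : ℝ) ^ 2 ≤ (p : ℝ) ^ 2 * s := le_mul_of_one_le_right (by positivity) hs1
      have a2 : ‖κ‖ ^ 2 * s ^ 2 ≤ R ^ 2 * (N * s) := by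
        refine mul_le_mul hk ?_ (by positivity) (by positivity)
        nlinarith [hs.2]
      linarith
    have e5 : ‖(s : ℂ)‖ ≤ N := by
      rw [Complex.norm_real, Real.norm_of_nonneg (by linarith)]; exact hs.2
    rw [mul_div_assoc]
    calc _ ≤ 1 * ((p : ℝ) ^ 2 + R ^ 2 * N) + 5 + N * 8 := by
          refine (norm_sub_le _ _).trans (add_le_add ((norm_sub_le _ _).trans (add_le_add ?_ e2)) ?_)
          · rw [norm_mul]
            exact mul_le_mul e1 e4 (norm_nonneg _) zero_le_one
          · rw [norm_mul]
            exact mul_le_mul e5 e3 (norm_nonneg _) (by linarith)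
      _ ≤ _ := by nlinarith [sq_nonneg (p : ℝ)]
  have h := intervalIntegral.norm_integral_le_of_norm_le
    (μ := MeasureTheory.volume) (a := N - 1) (b := N) (by linarith)
    (MeasureTheory.ae_of_all _ hbound) (Continuous.intervalIntegrable (by fun_prop) _ _)
  rw [hint, intervalIntegral.integral_const_mul, norm_mul, Complex.norm_real,
    Real.norm_of_nonneg (by linarith), mul_comm _ N, mul_assoc] at h
  exact le_of_mul_le_mul_left h (by linarith)

theorem sq_norm_besselJ_le_besselMass (p : ℕ) {κ : ℂ} {R : ℝ} (hκ : ‖κ‖ ≤ R) {N : ℝ}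
    (hN : 2 ≤ N) :
    (N - 1) * ‖besselJ p (κ * N)‖ ^ 2 ≤
      ((p : ℝ) ^ 2 + R ^ 2 + 13) ^ 2 * (N ^ 2 * besselMass p (κ * N)) := by
  have hN0 : N ≠ 0 := by linarith
  have hmass : N ^ 2 * besselMass p (κ * N) = ∫ s in (0 : ℝ)..N, s * ‖besselJ p (κ * s)‖ ^ 2 := by
    have := intervalIntegral.integral_comp_mul_left (a := 0) (b := 1)
      (fun s : ℝ => s * ‖besselJ p (κ * s)‖ ^ 2) hN0
    simp only [mul_zero, mul_one, smul_eq_mul] at this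
    rw [eq_inv_mul_iff_mul_eq₀ hN0, ← intervalIntegral.integral_const_mul] at this
    rw [← this, besselMass, ← intervalIntegral.integral_const_mul]
    refine intervalIntegral.integral_congr fun s _ => ?_
    simp only [Complex.ofReal_mul, mul_assoc]
    ring
  have hle : (N - 1) * ∫ s in (N - 1)..N, ‖besselJ p (κ * s)‖ ^ 2 ≤
      ∫ s in (0 : ℝ)..N, s * ‖besselJ p (κ * s)‖ ^ 2 := by
    have hi : ∀ a b, IntervalIntegrable (fun s : ℝ => s * ‖besselJ p (κ * s)‖ ^ 2)
        MeasureTheory.volume a b := fun a b => Continuous.intervalIntegrable (by fun_prop) _ _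
    rw [← intervalIntegral.integral_add_adjacent_intervals (hi 0 (N - 1)) (hi (N - 1) N),
      ← intervalIntegral.integral_const_mul]
    have h1 : 0 ≤ ∫ s in (0 : ℝ)..(N - 1), s * ‖besselJ p (κ * s)‖ ^ 2 :=
      intervalIntegral.integral_nonneg (by linarith) fun s hs => mul_nonneg hs.1 (by positivity)
    have h2 : ∫ s in (N - 1)..N, (N - 1) * ‖besselJ p (κ * s)‖ ^ 2 ≤
        ∫ s in (N - 1)..N, s * ‖besselJ p (κ * s)‖ ^ 2 :=
      intervalIntegral.integral_mono_on (by linarith)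
        (Continuous.intervalIntegrable (by fun_prop) _ _) (hi _ _)
        fun s hs => mul_le_mul_of_nonneg_right hs.1 (by positivity)
    linarith
  have hcs := sq_integral_le_integral_sq (h := fun s : ℝ => ‖besselJ p (κ * s)‖) (by fun_prop)
    (N - 1)
  rw [sub_add_cancel] at hcs
  have hsq := pow_le_pow_left₀ (norm_nonneg _) (norm_besselJ_le_integral p hκ hN) 2
  rw [mul_pow] at hsq
  rw [hmass]
  have hB : 0 ≤ ((p : ℝ) ^ 2 + R ^ 2 + 13) ^ 2 := by positivity
  calc _ ≤ (N - 1) * (((p : ℝ) ^ 2 + R ^ 2 + 13) ^ 2 *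
        ∫ s in (N - 1)..N, ‖besselJ p (κ * s)‖ ^ 2) :=
        mul_le_mul_of_nonneg_left (hsq.trans (mul_le_mul_of_nonneg_left hcs hB)) (by linarith)
    _ = ((p : ℝ) ^ 2 + R ^ 2 + 13) ^ 2 * ((N - 1) *
        ∫ s in (N - 1)..N, ‖besselJ p (κ * s)‖ ^ 2) := by ring
    _ ≤ _ := mul_le_mul_of_nonneg_left hle hB

end LowerBound

section Roots

variable {p : ℕ} {κ : ℂ} {N : ℝ}

theorem Fp_eq_besselT (p : ℕ) (κ : ℂ) (n : ℝ) :
    Fp p κ n = besselT p κ * besselJ p (κ * Real.sqrt n)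
      - besselJ p κ * besselT p (κ * Real.sqrt n) := by
  rw [Fp, besselT, besselT, mul_comm κ (Real.sqrt n : ℂ)]
  ring

theorem besselMass_mul_norm_sq_eq
    (h : besselT p κ * besselJ p (κ * N) = besselJ p κ * besselT p (κ * N))
    (hκ : (κ ^ 2).im ≠ 0) :
    besselMass p κ * ‖besselJ p (κ * N)‖ ^ 2 =
      N ^ 2 * ‖besselJ p κ‖ ^ 2 * besselMass p (κ * N) := by
  have h1 : (besselT p κ * (starRingEnd ℂ) (besselJ p κ)) * ((‖besselJ p (κ * N)‖ ^ 2 : ℝ) : ℂ) =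
      (besselT p (κ * N) * (starRingEnd ℂ) (besselJ p (κ * N))) * ((‖besselJ p κ‖ ^ 2 : ℝ) : ℂ) := by
    push_cast
    rw [← Complex.mul_conj', ← Complex.mul_conj']
    linear_combination (starRingEnd ℂ) (besselJ p κ) * (starRingEnd ℂ) (besselJ p (κ * N)) * h
  have h2 := congrArg Complex.im h1
  rw [Complex.im_mul_ofReal, Complex.im_mul_ofReal, im_besselT_mul_conj, im_besselT_mul_conj,
    mul_pow, ← Complex.ofReal_pow, Complex.im_mul_ofReal] at h2
  apply mul_left_cancel₀ hκ
  linear_combination -h2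

theorem sq_norm_besselJ_le
    (h : besselT p κ * besselJ p (κ * N) = besselJ p κ * besselT p (κ * N))
    (hκ : (κ ^ 2).im ≠ 0) {R : ℝ} (hR : ‖κ‖ ≤ R) (hN : 2 ≤ N) :
    (N - 1) * ‖besselJ p κ‖ ^ 2 ≤ ((p : ℝ) ^ 2 + R ^ 2 + 13) ^ 2 * besselMass p κ := by
  have h1 := besselMass_mul_norm_sq_eq h hκ
  have h2 := sq_norm_besselJ_le_besselMass p hR hN
  have hκ0 : κ ≠ 0 := by rintro rfl; simp at hκ
  have hm := besselMass_pos p hκ0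
  have hm' : 0 < besselMass p (κ * N) :=
    besselMass_pos p (mul_ne_zero hκ0 (by exact_mod_cast (by linarith : N ≠ 0)))
  rcases (norm_nonneg (besselJ p (κ * N))).eq_or_lt' with hb | hb
  · have : ‖besselJ p κ‖ ^ 2 = 0 := by
      rw [hb] at h1
      have hN0 : N ≠ 0 := by linarith
      simpa [hN0, hm'.ne'] using h1
    rw [this]
    nlinarith [mul_nonneg (sq_nonneg ((p : ℝ) ^ 2 + R ^ 2 + 13)) hm.le]
  · refine le_of_mul_le_mul_right ?_ (pow_pos hb 2)
    calc _ = ((N - 1) * ‖besselJ p (κ * N)‖ ^ 2) * ‖besselJ p κ‖ ^ 2 := by ring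
      _ ≤ _ := mul_le_mul_of_nonneg_right h2 (by positivity)
      _ = _ := by linear_combination -((p : ℝ) ^ 2 + R ^ 2 + 13) ^ 2 * h1

theorem besselJ_ne_zero_of_im_sq_ne_zero (hκ : (κ ^ 2).im ≠ 0) : besselJ p κ ≠ 0 := by
  intro h
  have h1 := im_besselT_mul_conj p κ
  have hκ0 : κ ≠ 0 := by rintro rfl; simp at hκ
  rw [h] at h1
  simp only [map_zero, mul_zero, Complex.zero_im] at h1
  rcases mul_eq_zero.1 h1.symm with h2 | h2
  · exact hκ (neg_eq_zero.1 h2)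
  · exact (besselMass_pos p hκ0).ne' h2

theorem conj_besselJ_zero_of_re_eq_zero (hκ : κ.re = 0) (s : ℝ) :
    (starRingEnd ℂ) (besselJ 0 (κ * s)) = besselJ 0 (κ * s) := by
  rw [conj_besselJ, ← besselJ_zero_neg (κ * s)]
  congr 1
  apply Complex.ext <;> simp [hκ]

theorem conj_besselJ_of_im_eq_zero (p : ℕ) (hκ : κ.im = 0) (s : ℝ) :
    (starRingEnd ℂ) (besselJ p (κ * s)) = besselJ p (κ * s) := by
  rw [conj_besselJ]
  congr 1
  apply Complex.ext <;> simp [hκ]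

theorem besselJ_zero_ne_zero_of_re_eq_zero (hκ : κ.re = 0) : besselJ 0 κ ≠ 0 := by
  rcases eq_or_ne κ 0 with rfl | hκ0
  · exact besselJ_zero_apply_zero_ne
  intro h
  have h1 := integral_besselJ_sq_of_real 0 (conj_besselJ_zero_of_re_eq_zero hκ)
  have h2 : (∫ s in (0 : ℝ)..1, (s : ℂ) * besselJ 0 (κ * s)) =
      ((∫ s in (0 : ℝ)..1, s * (besselJ 0 (κ * s)).re : ℝ) : ℂ) := by
    rw [← intervalIntegral.integral_ofReal]
    refine intervalIntegral.integral_congr fun s _ => ?_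
    simp [Complex.conj_eq_iff_re.1 (conj_besselJ_zero_of_re_eq_zero hκ s)]
  have hm := besselMass_pos 0 hκ0
  rw [h, besselT_zero_eq_integral, h2] at h1
  set r := ∫ s in (0 : ℝ)..1, s * (besselJ 0 (κ * s)).re
  have hsq : κ ^ 2 = ((-(κ.im ^ 2) : ℝ) : ℂ) := by
    apply Complex.ext <;> simp [pow_two, hκ]
  have hy : κ.im ≠ 0 := fun h0 => hκ0 (Complex.ext hκ h0)
  rw [hsq] at h1
  have h3 : 2 * (-(κ.im ^ 2)) * besselMass 0 κ = (-(-(κ.im ^ 2)) * r) ^ 2 := by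
    have := congrArg Complex.re h1
    norm_cast at this
    simpa using this
  have : 0 < κ.im ^ 2 * besselMass 0 κ := by positivity
  nlinarith [sq_nonneg (-(-(κ.im ^ 2)) * r)]

theorem besselJ_mul_ne_zero_of_real
    (h : besselT p κ * besselJ p (κ * N) = besselJ p κ * besselT p (κ * N))
    (hr : ∀ s : ℝ, (starRingEnd ℂ) (besselJ p (κ * s)) = besselJ p (κ * s))
    (hκ : κ ≠ 0) (hN : N ≠ 0) (hJ : besselJ p κ ≠ 0) : besselJ p (κ * N) ≠ 0 := by
  intro hb
  have hz : κ * N ≠ 0 := mul_ne_zero hκ (by exact_mod_cast hN)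
  have h2 := integral_besselJ_sq_of_real p (z := κ * N) fun s => by
    have := hr (N * s)
    push_cast at this
    rwa [mul_assoc]
  rw [hb, mul_zero, zero_eq_mul, or_iff_right hJ] at h
  rw [hb, h] at h2
  have := (besselMass_pos p hz).ne'
  simp [hz, this] at h2

theorem besselMass_mul_norm_sq_ne_of_real
    (h : besselT p κ * besselJ p (κ * N) = besselJ p κ * besselT p (κ * N))
    (hr : ∀ s : ℝ, (starRingEnd ℂ) (besselJ p (κ * s)) = besselJ p (κ * s))
    (hκ : κ ≠ 0) (hN : 1 < N) (hJ : besselJ p κ ≠ 0) :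
    besselMass p κ * ‖besselJ p (κ * N)‖ ^ 2 ≠
      N ^ 2 * ‖besselJ p κ‖ ^ 2 * besselMass p (κ * N) := by
  intro heq
  have hb := besselJ_mul_ne_zero_of_real h hr hκ (by linarith) hJ
  have h1 := integral_besselJ_sq_of_real p hr
  have h2 := integral_besselJ_sq_of_real p (z := κ * N) fun s => by
    have := hr (N * s)
    push_cast at this
    rwa [mul_assoc]
  have e : ∀ s : ℝ, (‖besselJ p (κ * s)‖ ^ 2 : ℂ) = besselJ p (κ * s) ^ 2 := fun s => by
    rw [← Complex.mul_conj', hr, pow_two]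
  have e1 := e 1
  rw [Complex.ofReal_one, mul_one] at e1
  have heq' : (besselMass p κ : ℂ) * besselJ p (κ * N) ^ 2 =
      N ^ 2 * besselJ p κ ^ 2 * besselMass p (κ * N) := by
    rw [← e1, ← e N]
    exact_mod_cast heq
  have h0 : κ ^ 2 * (besselJ p κ ^ 2 * besselJ p (κ * N) ^ 2 * (1 - (N : ℂ) ^ 2)) = 0 := by
    linear_combination -(besselJ p (κ * N) ^ 2) * h1 + besselJ p κ ^ 2 * h2 + 2 * κ ^ 2 * heq'
      - (besselT p κ * besselJ p (κ * N) + besselJ p κ * besselT p (κ * N)) * h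
  have hN2 : (1 - (N : ℂ) ^ 2) ≠ 0 := by
    have : 1 - N ^ 2 ≠ 0 := by nlinarith
    exact_mod_cast this
  simp [hκ, hb, hJ, hN2] at h0

end Roots

section RealRoots

variable {p : ℕ} {x : ℝ}

theorem ofReal_re_besselJ (p : ℕ) (x : ℝ) : ((besselJ p x).re : ℂ) = besselJ p x :=
  Complex.conj_eq_iff_re.1 (by rw [conj_besselJ, Complex.conj_ofReal])

theorem ofReal_re_besselT (p : ℕ) (x : ℝ) : ((besselT p x).re : ℂ) = besselT p x :=
  Complex.conj_eq_iff_re.1 (by rw [conj_besselT, Complex.conj_ofReal])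

/-- The logarithmic Euler derivative `x * J_p'(x) / J_p(x)` on the real line. -/
noncomputable def besselLog (p : ℕ) (x : ℝ) : ℝ := (besselT p x).re / (besselJ p x).re

theorem hasDerivAt_besselLog (hx : x ≠ 0) (hJ : (besselJ p x).re ≠ 0) :
    HasDerivAt (besselLog p) (-(x ^ 2 - (p : ℝ) ^ 2 + besselLog p x ^ 2) / x) x := by
  have hj : HasDerivAt (fun s : ℝ => (besselJ p s).re) ((besselT p x).re / x) x := by
    have := Complex.reCLM.hasFDerivAt.comp_hasDerivAt x (hasDerivAt_besselJ_ray p 1 hx)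
    simp only [one_mul] at this
    exact this.congr_deriv (by rw [Complex.reCLM_apply, Complex.div_ofReal_re])
  have ht : HasDerivAt (fun s : ℝ => (besselT p s).re)
      (((p : ℝ) ^ 2 - x ^ 2) * (besselJ p x).re / x) x := by
    have := Complex.reCLM.hasFDerivAt.comp_hasDerivAt x (hasDerivAt_besselT_ray p 1 hx)
    simp only [one_mul] at this
    refine this.congr_deriv ?_
    rw [Complex.reCLM_apply, Complex.div_ofReal_re, ← ofReal_re_besselJ]
    norm_cast
  refine (ht.fun_div hj hJ).congr_deriv ?_
  rw [besselLog]
  field_simp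
  ring

theorem sq_sub_sq_add_besselLog_sq_pos (hx : x ≠ 0) (hJ : (besselJ p x).re ≠ 0) :
    0 < x ^ 2 - (p : ℝ) ^ 2 + besselLog p x ^ 2 := by
  have h := integral_besselJ_sq_of_real p (z := (x : ℂ))
    (conj_besselJ_of_im_eq_zero p (Complex.ofReal_im x))
  rw [← ofReal_re_besselJ, ← ofReal_re_besselT] at h
  have h' : 2 * x ^ 2 * besselMass p x =
      (x ^ 2 - (p : ℝ) ^ 2) * (besselJ p x).re ^ 2 + (besselT p x).re ^ 2 := by
    exact_mod_cast h
  have hm := besselMass_pos p (z := (x : ℂ)) (by exact_mod_cast hx)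
  have : x ^ 2 - (p : ℝ) ^ 2 + besselLog p x ^ 2 =
      2 * x ^ 2 * besselMass p x / (besselJ p x).re ^ 2 := by
    rw [h', besselLog]
    field_simp
  rw [this]
  positivity

theorem eventually_re_besselJ_ne_zero (hJ : (besselJ p x).re ≠ 0) :
    ∀ᶠ y : ℝ in nhds x, (besselJ p y).re ≠ 0 :=
  ContinuousAt.eventually_ne (by fun_prop) hJ

/-- Real roots move strictly to the left as the index grows. -/
theorem eventually_besselLog_ne {c N : ℝ} (hc : 0 < c) (hN : 1 < N)
    (hJc : (besselJ p c).re ≠ 0) (hJN : (besselJ p ((c * N : ℝ) : ℂ)).re ≠ 0)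
    (h : besselLog p c = besselLog p (c * N)) :
    ∀ᶠ q : ℝ × ℝ in nhds (c, N), besselLog p q.1 = besselLog p (q.1 * q.2) →
      (N < q.2 → q.1 < c) ∧ (q.2 < N → c < q.1) := by
  have hcN : 0 < c * N := by positivity
  obtain ⟨ε, hε, hball⟩ := Metric.eventually_nhds_iff_ball.1
    ((eventually_re_besselJ_ne_zero hJN).and (eventually_gt_nhds hcN))
  have hanti : StrictAntiOn (besselLog p) (Metric.ball (c * N) ε) := by
    have hd : ∀ y ∈ Metric.ball (c * N) ε, HasDerivAt (besselLog p)
        (-(y ^ 2 - (p : ℝ) ^ 2 + besselLog p y ^ 2) / y) y := fun y hy =>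
      hasDerivAt_besselLog (hball y hy).2.ne' (hball y hy).1
    refine strictAntiOn_of_deriv_neg (convex_ball _ _)
      (fun y hy => (hd y hy).continuousAt.continuousWithinAt) fun y hy => ?_
    have hy' := interior_subset hy
    rw [(hd y hy').deriv]
    exact div_neg_of_neg_of_pos (neg_neg_of_pos
      (sq_sub_sq_add_besselLog_sq_pos (hball y hy').2.ne' (hball y hy').1)) (hball y hy').2
  have hΨ : HasDerivAt (fun y => besselLog p y - besselLog p (y * N)) ((N ^ 2 - 1) * c) c := by
    have h2 : HasDerivAt (fun y : ℝ => y * N) (1 * N) c := (hasDerivAt_id c).mul_const N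
    refine ((hasDerivAt_besselLog hc.ne' hJc).fun_sub
      ((hasDerivAt_besselLog hcN.ne' hJN).comp c h2)).congr_deriv ?_
    rw [h]
    field_simp
    ring
  have hsign := eventually_nhdsWithin_sign_eq_of_deriv_pos
    (f := fun y => besselLog p y - besselLog p (y * N))
    (by rw [hΨ.deriv]; nlinarith [mul_pos (sub_pos.2 hN) hc]) (sub_eq_zero.2 h)
  have c1 : Tendsto (fun q : ℝ × ℝ => q.1 * q.2) (nhds (c, N)) (nhds (c * N)) :=
    (continuous_fst.mul continuous_snd).tendsto (c, N)
  have c2 : Tendsto (fun q : ℝ × ℝ => q.1 * N) (nhds (c, N)) (nhds (c * N)) :=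
    (continuous_fst.mul continuous_const).tendsto (c, N)
  have c3 : Tendsto (fun q : ℝ × ℝ => q.1) (nhds (c, N)) (nhds c) := continuous_fst.tendsto (c, N)
  filter_upwards [c1.eventually (Metric.ball_mem_nhds _ hε), c2.eventually
    (Metric.ball_mem_nhds _ hε), c3.eventually hsign, c3.eventually (eventually_gt_nhds hc)]
    with q h1 h2 h3 h4 heq
  constructor
  · intro hq
    by_contra! hle
    have hlt := hanti h2 h1 (mul_lt_mul_of_pos_left hq h4)
    have : 0 ≤ SignType.sign (besselLog p q.1 - besselLog p (q.1 * N)) := by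
      rw [h3]; exact sign_nonneg_iff.2 (by linarith)
    have := sign_nonneg_iff.1 this
    linarith
  · intro hq
    by_contra! hle
    have hlt := hanti h1 h2 (mul_lt_mul_of_pos_left hq h4)
    have : SignType.sign (besselLog p q.1 - besselLog p (q.1 * N)) ≤ 0 := by
      rw [h3]; exact sign_nonpos_iff.2 (by linarith)
    have := sign_nonpos_iff.1 this
    linarith

end RealRoots

section Trajectory

/-- Evolution of a curve whose real points away from `k` move to the left along the real axis. -/
theorem re_lt_of_eventually_re_lt {γ : ℝ → ℂ} {a b k : ℝ} (hab : a ≤ b)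
    (hγ : ContinuousOn γ (Icc a b))
    (hloc : ∀ n ∈ Ico a b, (γ n).im = 0 → (γ n).re ≠ k →
      ∀ᶠ m in nhdsWithin n (Ioi n), (γ m).im = 0 ∧ (γ m).re < (γ n).re)
    (him : (γ a).im = 0) (hre : (γ a).re < k) : (γ b).re < k := by
  have hsub : Icc a b ⊆ {n | (γ n).im = 0 ∧ (γ n).re ≤ (γ a).re} := by
    refine IsClosed.Icc_subset_of_forall_mem_nhdsWithin ?_ ⟨him, le_rfl⟩ fun n hn => ?_
    · have hS : IsClosed {z : ℂ | z.im = 0 ∧ z.re ≤ (γ a).re} :=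
        (isClosed_eq Complex.continuous_im continuous_const).inter
          (isClosed_le Complex.continuous_re continuous_const)
      rw [inter_comm]
      exact hγ.preimage_isClosed_of_isClosed isClosed_Icc hS
    · filter_upwards [hloc n hn.2 hn.1.1 (hn.1.2.trans_lt hre).ne] with m hm
      exact ⟨hm.1, hm.2.le.trans hn.1.2⟩
  exact (hsub (right_mem_Icc.2 hab)).2.trans_lt hre

variable {p : ℕ} {κ : ℝ → ℂ}

theorem one_lt_sqrt {n : ℝ} (hn : 1 < n) : 1 < Real.sqrt n := by
  rw [Real.lt_sqrt zero_le_one]; simpa using hn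

theorem eventually_im_sq_eq_zero {n : ℝ} (hn : 1 < n) (hκ : ContinuousAt κ n)
    (hF : ∀ m : ℝ, 1 < m → besselT p (κ m) * besselJ p (κ m * Real.sqrt m) =
      besselJ p (κ m) * besselT p (κ m * Real.sqrt m))
    (hr : ∀ s : ℝ, (starRingEnd ℂ) (besselJ p (κ n * s)) = besselJ p (κ n * s))
    (h0 : κ n ≠ 0) (hJ : besselJ p (κ n) ≠ 0) :
    ∀ᶠ m in nhds n, (κ m ^ 2).im = 0 := by
  have hne := sub_ne_zero.2
    (besselMass_mul_norm_sq_ne_of_real (hF n hn) hr h0 (one_lt_sqrt hn) hJ)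
  have hm := continuous_besselMass p
  have hcont : ContinuousAt (fun m => besselMass p (κ m) * ‖besselJ p (κ m * Real.sqrt m)‖ ^ 2 -
      Real.sqrt m ^ 2 * ‖besselJ p (κ m)‖ ^ 2 * besselMass p (κ m * Real.sqrt m)) n := by
    fun_prop
  filter_upwards [hcont.eventually_ne hne, eventually_gt_nhds hn] with m h1 h2
  by_contra h3
  exact h1 (sub_eq_zero.2 (besselMass_mul_norm_sq_eq (hF m h2) h3))

theorem eventually_eq_zero {n : ℝ} (hn : 1 < n) (hκ : ContinuousAt κ n)
    (hF : ∀ m : ℝ, 1 < m → besselT 0 (κ m) * besselJ 0 (κ m * Real.sqrt m) =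
      besselJ 0 (κ m) * besselT 0 (κ m * Real.sqrt m))
    (h0 : κ n = 0) : ∀ᶠ m in nhds n, κ m = 0 := by
  set k : ℂ → ℂ := fun z => ∫ s in (0 : ℝ)..1, (s : ℂ) * besselJ 0 (z * s) with hk
  have hkc : Continuous k :=
    intervalIntegral.continuous_parametric_intervalIntegral_of_continuous'
      (f := fun (z : ℂ) (s : ℝ) => (s : ℂ) * besselJ 0 (z * s))
      (by unfold Function.uncurry; fun_prop) 0 1
  have hk0 : k 0 = besselJ 0 0 / 2 := by
    have : ∫ s in (0 : ℝ)..1, (s : ℂ) = 1 / 2 := by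
      rw [intervalIntegral.integral_ofReal]; norm_num
    simp only [hk, zero_mul, intervalIntegral.integral_mul_const, this]
    ring
  have hcont : ContinuousAt (fun m => k (κ m) * besselJ 0 (κ m * Real.sqrt m) -
      (Real.sqrt m : ℂ) ^ 2 * besselJ 0 (κ m) * k (κ m * Real.sqrt m)) n := by
    fun_prop
  have hne : k (κ n) * besselJ 0 (κ n * Real.sqrt n) -
      (Real.sqrt n : ℂ) ^ 2 * besselJ 0 (κ n) * k (κ n * Real.sqrt n) ≠ 0 := by
    have hs : (1 - (Real.sqrt n : ℂ) ^ 2) ≠ 0 := by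
      have : 1 - Real.sqrt n ^ 2 ≠ 0 := by nlinarith [one_lt_sqrt hn]
      exact_mod_cast this
    rw [h0, zero_mul, hk0]
    have : besselJ 0 0 / 2 * besselJ 0 0 - (Real.sqrt n : ℂ) ^ 2 * besselJ 0 0 * (besselJ 0 0 / 2) =
      besselJ 0 0 ^ 2 / 2 * (1 - (Real.sqrt n : ℂ) ^ 2) := by ring
    rw [this]
    exact mul_ne_zero (div_ne_zero (pow_ne_zero _ besselJ_zero_apply_zero_ne) two_ne_zero) hs
  filter_upwards [hcont.eventually_ne hne, eventually_gt_nhds hn] with m h1 h2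
  by_contra h3
  have h4 := hF m h2
  rw [besselT_zero_eq_integral, besselT_zero_eq_integral] at h4
  refine h1 (mul_left_cancel₀ (pow_ne_zero 2 h3) ?_)
  linear_combination -h4

theorem eventually_re_eq_zero {n : ℝ} (hn : 1 < n) (hκ : ContinuousAt κ n)
    (hF : ∀ m : ℝ, 1 < m → besselT 0 (κ m) * besselJ 0 (κ m * Real.sqrt m) =
      besselJ 0 (κ m) * besselT 0 (κ m * Real.sqrt m))
    (h0 : (κ n).re = 0) : ∀ᶠ m in nhds n, (κ m).re = 0 := by
  rcases eq_or_ne (κ n) 0 with h | h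
  · filter_upwards [eventually_eq_zero hn hκ hF h] with m hm
    simp [hm]
  · have him : (κ n).im ≠ 0 := fun h1 => h (Complex.ext h0 h1)
    have hc : ContinuousAt (fun m => (κ m).im) n := by fun_prop
    filter_upwards [hc.eventually_ne him, eventually_im_sq_eq_zero hn hκ hF
      (conj_besselJ_zero_of_re_eq_zero h0) h (besselJ_zero_ne_zero_of_re_eq_zero h0)] with m h1 h2
    simp only [pow_two, Complex.mul_im] at h2
    have : (κ m).re * (κ m).im = 0 := by linarith
    exact (mul_eq_zero.1 this).resolve_right h1

theorem eventually_real_and_re_lt {n : ℝ} (hn : 1 < n) (hκ : ContinuousAt κ n)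
    (hF : ∀ m : ℝ, 1 < m → besselT p (κ m) * besselJ p (κ m * Real.sqrt m) =
      besselJ p (κ m) * besselT p (κ m * Real.sqrt m))
    (him : (κ n).im = 0) (hre : 0 < (κ n).re) (hJ : besselJ p (κ n) ≠ 0) :
    ∀ᶠ m in nhds n, (κ m).im = 0 ∧ (n < m → (κ m).re < (κ n).re) ∧
      (m < n → (κ n).re < (κ m).re) := by
  have h0 : κ n ≠ 0 := fun h => by simp [h] at hre
  have hN := one_lt_sqrt hn
  have hr := conj_besselJ_of_im_eq_zero p him
  have hJN := besselJ_mul_ne_zero_of_real (hF n hn) hr h0 (by linarith) hJ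
  have hlog : ∀ m, 1 < m → (κ m).im = 0 →
      (besselJ p ((κ m).re : ℂ)).re ≠ 0 →
      (besselJ p (((κ m).re * Real.sqrt m : ℝ) : ℂ)).re ≠ 0 →
      besselLog p (κ m).re = besselLog p ((κ m).re * Real.sqrt m) := by
    intro m hm hi h1 h2
    have h3 := hF m hm
    rw [show κ m = ((κ m).re : ℂ) from Complex.ext rfl (by simpa using hi), ← Complex.ofReal_mul,
      ← ofReal_re_besselJ p (κ m).re, ← ofReal_re_besselJ p ((κ m).re * Real.sqrt m),
      ← ofReal_re_besselT p (κ m).re, ← ofReal_re_besselT p ((κ m).re * Real.sqrt m)] at h3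
    rw [besselLog, besselLog, div_eq_div_iff h1 h2]
    have h4 : (besselT p ((κ m).re : ℂ)).re * (besselJ p (((κ m).re * Real.sqrt m : ℝ) : ℂ)).re =
        (besselJ p ((κ m).re : ℂ)).re * (besselT p (((κ m).re * Real.sqrt m : ℝ) : ℂ)).re := by
      exact_mod_cast h3
    rw [h4, mul_comm]
  have hκn : κ n = ((κ n).re : ℂ) := Complex.ext rfl (by simpa using him)
  have hJ' : (besselJ p ((κ n).re : ℂ)).re ≠ 0 := fun h => hJ (by
    rw [hκn, ← ofReal_re_besselJ, h, Complex.ofReal_zero])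
  have hJN' : (besselJ p (((κ n).re * Real.sqrt n : ℝ) : ℂ)).re ≠ 0 := fun h => hJN (by
    rw [hκn, ← Complex.ofReal_mul, ← ofReal_re_besselJ, h, Complex.ofReal_zero])
  have hcre : ContinuousAt (fun m => (κ m).re) n := by fun_prop
  have hcmul : ContinuousAt (fun m => (κ m).re * Real.sqrt m) n := by fun_prop
  have hpair : Tendsto (fun m => ((κ m).re, Real.sqrt m)) (nhds n)
      (nhds ((κ n).re, Real.sqrt n)) :=
    hcre.tendsto.prodMk_nhds (Real.continuous_sqrt.tendsto n)
  filter_upwards [eventually_im_sq_eq_zero hn hκ hF hr h0 hJ, hcre.eventually (lt_mem_nhds hre),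
    eventually_gt_nhds hn, hcre.eventually (eventually_re_besselJ_ne_zero hJ'),
    hcmul.eventually (eventually_re_besselJ_ne_zero hJN'),
    hpair.eventually (eventually_besselLog_ne hre hN hJ' hJN' (hlog n hn him hJ' hJN'))]
    with m h1 h2 h3 h4 h5 h6
  have hi : (κ m).im = 0 := by
    simp only [pow_two, Complex.mul_im] at h1
    have : (κ m).re * (κ m).im = 0 := by linarith
    exact (mul_eq_zero.1 this).resolve_left h2.ne'
  have h7 := h6 (hlog m h3 hi h4 h5)
  exact ⟨hi, fun h => h7.1 (Real.sqrt_lt_sqrt (by linarith) h),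
    fun h => h7.2 (Real.sqrt_lt_sqrt (by linarith) h)⟩

end Trajectory

/-- a bounded, IDE-recurrent ITE trajectory converges to the IDE as `n → ∞`. -/
theorem stmt_17 (p : ℕ) (κs : ℝ) (hκs : 0 < κs) (hJ : besselJ p (κs : ℂ) = 0)
    (ym yp : ℝ) (hym : ym < κs) (hyp : κs < yp)
    (huniq : ∀ x ∈ Set.Icc ym yp, besselJ p (x : ℂ) = 0 → x = κs)
    (C : ℝ) (hC : 0 < C)
    (κ : ℝ → ℂ) (hcont : ContinuousOn κ (Set.Ioi (1 : ℝ)))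
    (hF : ∀ n : ℝ, 1 < n → Fp p (κ n) n = 0)
    (hre : ∀ n : ℝ, 1 < n → ym ≤ (κ n).re ∧ (κ n).re ≤ yp)
    (him : ∀ n : ℝ, 1 < n → -C ≤ (κ n).im ∧ (κ n).im ≤ C)
    (hrec : ∀ M : ℝ, ∃ n : ℝ, M < n ∧ 1 < n ∧ κ n = (κs : ℂ)) :
    Filter.Tendsto κ Filter.atTop (nhds ((κs : ℝ) : ℂ)) := by
  have hF' : ∀ m : ℝ, 1 < m → besselT p (κ m) * besselJ p (κ m * Real.sqrt m) =
      besselJ p (κ m) * besselT p (κ m * Real.sqrt m) := fun m hm =>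
    sub_eq_zero.1 ((Fp_eq_besselT p (κ m) m).symm.trans (hF m hm))
  have hκc : ∀ n : ℝ, 1 < n → ContinuousAt κ n := fun n hn => hcont.continuousAt (Ioi_mem_nhds hn)
  have hym_pos : 0 < p → 0 < ym := by
    intro hp
    by_contra! h
    have := huniq 0 ⟨h, by linarith⟩ (by simpa using besselJ_apply_zero_of_pos hp)
    linarith
  have hre_ne : ∀ n : ℝ, 1 < n → (κ n).re ≠ 0 := by
    intro n hn h0
    rcases Nat.eq_zero_or_pos p with rfl | hp
    · obtain ⟨b, hnb, hb, hκb⟩ := hrec n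
      have hc : ContinuousOn κ (Icc n b) := hcont.mono fun m hm => hn.trans_le hm.1
      have hsub : Icc n b ⊆ {m | (κ m).re = 0} := by
        refine IsClosed.Icc_subset_of_forall_mem_nhdsWithin ?_ h0 fun m hm => ?_
        · rw [inter_comm]
          exact hc.preimage_isClosed_of_isClosed isClosed_Icc
            (isClosed_eq Complex.continuous_re continuous_const)
        · have hm1 := hn.trans_le hm.2.1
          exact nhdsWithin_le_nhds (eventually_re_eq_zero hm1 (hκc m hm1) hF' hm.1)
      have : (κ b).re = 0 := hsub (right_mem_Icc.2 hnb.le)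
      rw [hκb, Complex.ofReal_re] at this
      exact hκs.ne' this
    · linarith [hym_pos hp, (hre n hn).1]
  have hpos : ∀ n : ℝ, 1 < n → 0 < (κ n).re := by
    intro n hn
    by_contra! hneg
    obtain ⟨b, hnb, hb, hκb⟩ := hrec n
    have hc : ContinuousOn (fun m => (κ m).re) (Icc n b) :=
      Complex.continuous_re.comp_continuousOn (hcont.mono fun m hm => hn.trans_le hm.1)
    obtain ⟨m, hm, hm0⟩ := intermediate_value_Icc hnb.le hc
      (show (0 : ℝ) ∈ _ from ⟨hneg, by rw [hκb, Complex.ofReal_re]; exact hκs.le⟩)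
    exact hre_ne m (hn.trans_le hm.1) hm0
  have hloc : ∀ n : ℝ, 1 < n → (κ n).im = 0 → (κ n).re ≠ κs →
      ∀ᶠ m in nhds n, (κ m).im = 0 ∧ (n < m → (κ m).re < (κ n).re) ∧
        (m < n → (κ n).re < (κ m).re) := by
    intro n hn hi hk
    refine eventually_real_and_re_lt hn (hκc n hn) hF' hi (hpos n hn) fun h => hk ?_
    refine huniq _ (hre n hn) ?_
    rwa [show ((κ n).re : ℂ) = κ n from Complex.ext rfl (by simpa using hi.symm)]
  obtain ⟨a, -, ha, hκa⟩ := hrec 1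
  have hdich : ∀ n : ℝ, a < n → κ n = κs ∨ (κ n).im ≠ 0 := by
    intro n han
    by_contra! h
    obtain ⟨hne, hi⟩ := h
    have hn : 1 < n := ha.trans han
    have hk : (κ n).re ≠ κs := fun h => hne (Complex.ext (by simpa using h) (by simpa using hi))
    rcases hk.lt_or_gt with hlt | hgt
    · obtain ⟨b, hnb, hb, hκb⟩ := hrec n
      have := re_lt_of_eventually_re_lt hnb.le (hcont.mono fun m hm => hn.trans_le hm.1)
        (fun m hm hmi hmk => by
          filter_upwards [nhdsWithin_le_nhds (hloc m (hn.trans_le hm.1) hmi hmk),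
            self_mem_nhdsWithin] with q hq hmq
          exact ⟨hq.1, hq.2.1 hmq⟩) hi hlt
      rw [hκb, Complex.ofReal_re] at this
      exact lt_irrefl _ this
    · have := re_lt_of_eventually_re_lt (γ := fun u => -κ (-u)) (a := -n) (b := -a) (k := -κs)
        (neg_le_neg han.le)
        ((hcont.comp continuous_neg.continuousOn
          fun m hm => ha.trans_le (by simpa using neg_le_neg hm.2)).neg)
        (fun m hm hmi hmk => by
          have hm1 : 1 < -m := ha.trans (by linarith [hm.2])
          have hev := hloc (-m) hm1 (by simpa using hmi) fun h => hmk (by simp [h])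
          filter_upwards [nhdsWithin_le_nhds ((continuous_neg.tendsto m).eventually hev),
            self_mem_nhdsWithin] with q hq hmq
          exact ⟨by simpa using hq.1, by simpa using hq.2.2 (neg_lt_neg hmq)⟩)
        (by simpa using hi) (by simpa using hgt)
      simp [hκa] at this
  set K : Set ℂ := Icc ym yp ×ℂ Icc (-C) C with hK
  have hKc : IsCompact K := isCompact_Icc.reProdIm isCompact_Icc
  have hmem : ∀ n : ℝ, 1 < n → κ n ∈ K := fun n hn => ⟨hre n hn, him n hn⟩
  obtain ⟨M, hM⟩ := hKc.exists_bound_of_continuousOn (continuous_besselMass p).continuousOn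
  obtain ⟨R, hR⟩ := hKc.exists_bound_of_continuousOn (f := fun z : ℂ => z) continuousOn_id
  have hlim : Tendsto (fun n => ‖besselJ p (κ n)‖ ^ 2) atTop (nhds 0) := by
    have hden : Tendsto (fun n : ℝ => Real.sqrt n - 1) atTop atTop :=
      tendsto_atTop_add_const_right _ _ Real.tendsto_sqrt_atTop
    refine squeeze_zero' (Eventually.of_forall fun n => by positivity) ?_
      (hden.const_div_atTop (((p : ℝ) ^ 2 + R ^ 2 + 13) ^ 2 * M))
    filter_upwards [eventually_gt_atTop a, eventually_ge_atTop 4] with n hna hn4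
    have hn : 1 < n := by linarith
    have hN : 2 ≤ Real.sqrt n := Real.le_sqrt_of_sq_le (by linarith)
    have hm := (le_abs_self _).trans (hM _ (hmem n hn))
    rw [le_div_iff₀ (by linarith), mul_comm]
    rcases hdich n hna with h | h
    · have hM0 : 0 ≤ M := (norm_nonneg _).trans (hM _ (hmem n hn))
      rw [h, hJ, norm_zero]
      simp only [ne_eq, OfNat.ofNat_ne_zero, not_false_eq_true, zero_pow, mul_zero]
      positivity
    · refine (sq_norm_besselJ_le (hF' n hn) ?_ (hR _ (hmem n hn)) hN).trans
        (mul_le_mul_of_nonneg_left hm (by positivity))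
      rw [pow_two, Complex.mul_im]
      have := mul_ne_zero (hpos n hn).ne' h
      intro h0
      exact this (by linarith)
  refine hKc.tendsto_nhds_of_unique_mapClusterPt
    ((eventually_gt_atTop 1).mono hmem) fun z hz hcl => ?_
  have hJz : besselJ p z = 0 := by
    have h1 : MapClusterPt (‖besselJ p z‖ ^ 2) atTop (fun n => ‖besselJ p (κ n)‖ ^ 2) :=
      hcl.continuousAt_comp (f := fun z => ‖besselJ p z‖ ^ 2) (by fun_prop)
    have : (nhds (‖besselJ p z‖ ^ 2) ⊓ nhds (0 : ℝ)).NeBot := ClusterPt.mono h1 hlim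
    simpa using eq_of_nhds_neBot this
  by_cases hzi : z.im = 0
  · have hz' : ((z.re : ℝ) : ℂ) = z := Complex.ext rfl (by simpa using hzi.symm)
    rw [← hz', huniq z.re hz.1 (by rwa [hz'])]
  · exfalso
    have hzr : z.re ≠ 0 := by
      intro h0
      rcases Nat.eq_zero_or_pos p with rfl | hp
      · exact besselJ_zero_ne_zero_of_re_eq_zero h0 hJz
      · linarith [hym_pos hp, hz.1.1]
    refine besselJ_ne_zero_of_im_sq_ne_zero ?_ hJz
    rw [pow_two, Complex.mul_im]
    have := mul_ne_zero hzr hzi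
    intro h0
    exact this (by linarith)
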